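/- Convergence of finite-level (game) values: let m ≥ 2, let (p_k), (q_k) ⊂ [0,1) and (β^u_k), (β^v_k) ⊂ [0,c] with c < 1 and β^u_0 = β^v_0 = 0, and assume ∑_{k=1}^∞ p_k < ∞, ∑_{k=1}^∞ q_k < ∞, ∑_{k=1}^∞ ∏_{j=1}^k β^u_j/(1−β^u_j) < ∞, and ∑_{k=1}^∞ ∏_{j=1}^k β^v_j/(1−β^v_j) < ∞. Fix continuous functions f, g : [0,1] → ℝ. For each L ∈ ℕ, let (u_L, v_L) be a pair of real functions on the vertices of T_m of level at most L that satisfies the two equations of the system (ED1.99) at every vertex of level strictly less than L and satisfies u_L(x) = f(ψ(x)) and v_L(x) = g(ψ(x)) at every vertex x of level L, where ψ(x) = ψ of the branch obtained by extending x with zeros. Then for every vertex x ∈ T_m, u_L(x) → u(x) and v_L(x) → v(x) as L → ∞, where (u,v) is the unique solution of the system (ED1.99) on the whole tree satisfying, along every branch π, u(x_n) → f(ψ(π)) and v(x_n) → g(ψ(π)). -/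

import Mathlib

open Filter Topology

noncomputable section

/-- The level-`n` truncation of a branch `π` of the `m`-regular tree. -/
def trunc {m : ℕ} (π : ℕ → Fin m) (n : ℕ) : List (Fin m) :=
  List.ofFn (fun i : Fin n => π i)

/-- `ψ(π) = ∑_{k≥1} a_k m^{-k}` for a branch `π = (a_1, a_2, …)`. -/
def psi (m : ℕ) (π : ℕ → Fin m) : ℝ :=
  ∑' k : ℕ, (π k : ℝ) / (m : ℝ) ^ (k + 1)

/-- `ψ(x)` for a vertex `x`: the value of `ψ` on the branch extending `x` by zeros. -/
def psiVertex (m : ℕ) (x : List (Fin m)) : ℝ :=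
  ∑ i : Fin x.length, (x.get i : ℝ) / (m : ℝ) ^ ((i : ℕ) + 1)

/-- Maximum of `u` over the successors of the vertex `x`. -/
def treeMax (m : ℕ) (u : List (Fin m) → ℝ) (x : List (Fin m)) : ℝ :=
  ⨆ i : Fin m, u (x ++ [i])

/-- Minimum of `u` over the successors of the vertex `x`. -/
def treeMin (m : ℕ) (u : List (Fin m) → ℝ) (x : List (Fin m)) : ℝ :=
  ⨅ i : Fin m, u (x ++ [i])

/-- Average of `v` over the successors of the vertex `x`. -/
def treeAvg (m : ℕ) (v : List (Fin m) → ℝ) (x : List (Fin m)) : ℝ :=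
  (1 / (m : ℝ)) * ∑ i : Fin m, v (x ++ [i])

/-- The equations of the system (ED1.99) hold at the vertex `x`. -/
def SolED199At (m : ℕ) (p q βu βv : ℕ → ℝ) (u v : List (Fin m) → ℝ)
    (x : List (Fin m)) : Prop :=
  u x = (1 - p x.length) * ((1 - βu x.length) *
          ((1 / 2) * treeMax m u x + (1 / 2) * treeMin m u x)
          + βu x.length * u x.dropLast) + p x.length * v x ∧
  v x = (1 - q x.length) * ((1 - βv x.length) * treeAvg m v x
          + βv x.length * v x.dropLast) + q x.length * u x

/-- The pair `(u, v)` satisfies the boundary condition along every branch. -/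
def BoundaryCond (m : ℕ) (f g : ℝ → ℝ) (u v : List (Fin m) → ℝ) : Prop :=
  ∀ π : ℕ → Fin m,
    Tendsto (fun n => u (trunc π n)) atTop (𝓝 (f (psi m π))) ∧
    Tendsto (fun n => v (trunc π n)) atTop (𝓝 (g (psi m π)))


lemma trunc_length {m : ℕ} (π : ℕ → Fin m) (n : ℕ) : (trunc π n).length = n := by
  simp [trunc]

lemma trunc_succ {m : ℕ} (π : ℕ → Fin m) (n : ℕ) : trunc π (n+1) = trunc π n ++ [π n] := by
  rw [trunc, List.ofFn_succ_last]; rfl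

lemma exists_branch {m : ℕ} (hm : 2 ≤ m) (x : List (Fin m)) :
    ∃ π : ℕ → Fin m, ∀ n, n ≤ x.length → trunc π n = x.take n := by
  refine ⟨fun n => x.getD n ⟨0, by omega⟩, fun n hn => ?_⟩
  apply List.ext_getElem
  · simp [trunc, hn]
  · intro i h1 h2
    simp [trunc] at h1 h2 ⊢
    simp [h2.2]

lemma fan {m : ℕ} (hm : 2 ≤ m) (P : List (Fin m) → Prop)
    (h : ∀ π : ℕ → Fin m, ∃ n, P (trunc π n)) :
    ∃ N, ∀ x : List (Fin m), N ≤ x.length → ∃ z, z <+: x ∧ z.length ≤ N ∧ P z := by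
  let U : ℕ → Set (ℕ → Fin m) := fun n => {π | P (trunc π n)}
  have hU : ∀ n, IsOpen (U n) := by
    intro n
    have hc : Continuous (fun (π : ℕ → Fin m) (i : Fin n) => π i) := by fun_prop
    have : U n = (fun (π : ℕ → Fin m) (i : Fin n) => π i) ⁻¹' {r | P (List.ofFn r)} := rfl
    rw [this]
    exact (isOpen_discrete _).preimage hc
  obtain ⟨t, ht⟩ := isCompact_univ.elim_finite_subcover U hU
    (fun π _ => by obtain ⟨n, hn⟩ := h π; exact Set.mem_iUnion.2 ⟨n, hn⟩)
  refine ⟨t.sup id, fun x hx => ?_⟩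
  obtain ⟨π, hπ⟩ := exists_branch hm x
  obtain ⟨n, hn, hn'⟩ := Set.mem_iUnion₂.1 (ht (Set.mem_univ π))
  have hle : n ≤ t.sup id := Finset.le_sup (f := id) hn
  refine ⟨trunc π n, ?_, ?_, hn'⟩
  · rw [hπ n (hle.trans hx)]; exact List.take_prefix _ _
  · rw [trunc_length]; exact hle

lemma maxprin {m : ℕ} (W : List (Fin m) → ℝ) (I : Set (List (Fin m))) (N : ℕ)
    (hN : ∀ x ∈ I, x.length < N)
    (hc : ∀ x ∈ I, ∀ i, x ++ [i] ∉ I → W (x ++ [i]) ≤ 0)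
    (hd : ∀ x ∈ I, x.dropLast ∉ I → W x.dropLast ≤ 0)
    (h : ∀ x ∈ I, 0 < W x → ∃ b : ℝ, 0 ≤ b ∧ b < 1 ∧ ∃ i,
      W x ≤ (1 - b) * W (x ++ [i]) + b * W x.dropLast) :
    ∀ x ∈ I, W x ≤ 0 := by
  by_contra! hcon
  obtain ⟨x0, hx0, hpos⟩ := hcon
  have hfin : I.Finite := (List.finite_length_lt (Fin m) N).subset hN
  obtain ⟨x1, hx1, hmax⟩ := Set.exists_max_image I W hfin ⟨x0, hx0⟩
  set M := W x1
  have hMpos : 0 < M := hpos.trans_le (hmax x0 hx0)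
  let J := {x ∈ I | W x = M}
  have hJ : J.Finite := hfin.subset (fun x hx => hx.1)
  obtain ⟨x, hx, hlong⟩ := Set.exists_max_image J List.length hJ ⟨x1, hx1, rfl⟩
  obtain ⟨b, hb0, hb1, i, hi⟩ := h x hx.1 (hx.2 ▸ hMpos)
  rw [hx.2] at hi
  have h1 : W (x ++ [i]) < M := by
    by_cases hI : x ++ [i] ∈ I
    · refine lt_of_le_of_ne (hmax _ hI) fun he => ?_
      have := hlong _ ⟨hI, he⟩
      simp at this
    · exact (hc x hx.1 i hI).trans_lt hMpos
  have h2 : W x.dropLast ≤ M := by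
    by_cases hI : x.dropLast ∈ I
    · exact hmax _ hI
    · exact (hd x hx.1 hI).trans hMpos.le
  nlinarith [mul_lt_mul_of_pos_left h1 (sub_pos.2 hb1), mul_le_mul_of_nonneg_left h2 hb0]

lemma mid_diff {m : ℕ} (hm : 2 ≤ m) (u u' : List (Fin m) → ℝ) (x : List (Fin m)) :
    ∃ i, |((1 / 2) * treeMax m u x + (1 / 2) * treeMin m u x) -
      ((1 / 2) * treeMax m u' x + (1 / 2) * treeMin m u' x)| ≤ |u (x ++ [i]) - u' (x ++ [i])| := by
  have : Nonempty (Fin m) := ⟨⟨0, by omega⟩⟩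
  obtain ⟨i, hi⟩ := Finite.exists_max (fun i : Fin m => |u (x ++ [i]) - u' (x ++ [i])|)
  refine ⟨i, ?_⟩
  set d := |u (x ++ [i]) - u' (x ++ [i])|
  have B : ∀ w : List (Fin m) → ℝ, BddAbove (Set.range fun i : Fin m => w (x ++ [i])) :=
    fun w => Set.Finite.bddAbove (Set.finite_range _)
  have B' : ∀ w : List (Fin m) → ℝ, BddBelow (Set.range fun i : Fin m => w (x ++ [i])) :=
    fun w => Set.Finite.bddBelow (Set.finite_range _)
  have key : ∀ w w' : List (Fin m) → ℝ, (∀ i, w (x ++ [i]) ≤ w' (x ++ [i]) + d) →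
      treeMax m w x ≤ treeMax m w' x + d ∧ treeMin m w x ≤ treeMin m w' x + d := by
    intro w w' hw
    constructor
    · exact ciSup_le fun j => (hw j).trans (by
        have := le_ciSup (B w') j
        simp only [treeMax]; linarith)
    · have : treeMin m w x - d ≤ treeMin m w' x := le_ciInf fun j => by
        have := ciInf_le (B' w) j
        have := hw j
        simp only [treeMin]; linarith
      linarith
  have k1 := key u u' (fun j => by have := (abs_le.1 (hi j)).2; linarith)
  have k2 := key u' u (fun j => by have := (abs_le.1 (hi j)).1; linarith)
  rw [abs_le]; constructor <;> linarith [k1.1, k1.2, k2.1, k2.2]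

lemma avg_diff {m : ℕ} (hm : 2 ≤ m) (u u' : List (Fin m) → ℝ) (x : List (Fin m)) :
    ∃ i, |treeAvg m u x - treeAvg m u' x| ≤ |u (x ++ [i]) - u' (x ++ [i])| := by
  have : Nonempty (Fin m) := ⟨⟨0, by omega⟩⟩
  obtain ⟨i, hi⟩ := Finite.exists_max (fun i : Fin m => |u (x ++ [i]) - u' (x ++ [i])|)
  refine ⟨i, ?_⟩
  have hm0 : (0:ℝ) < m := by exact_mod_cast (by omega : 0 < m)
  simp only [treeAvg]
  rw [← mul_sub, ← Finset.sum_sub_distrib, abs_mul, abs_of_pos (by positivity)]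
  have : |∑ j : Fin m, (u (x ++ [j]) - u' (x ++ [j]))| ≤ m * |u (x ++ [i]) - u' (x ++ [i])| := by
    refine (Finset.abs_sum_le_sum_abs _ _).trans ?_
    refine (Finset.sum_le_sum fun j _ => hi j).trans ?_
    simp
  calc _ ≤ 1 / (m:ℝ) * (m * |u (x ++ [i]) - u' (x ++ [i])|) := by gcongr
    _ = _ := by field_simp

lemma comb_abs (p b A A' B B' C C' r : ℝ) (hp0 : 0 ≤ p) (hp1 : p < 1) (hb0 : 0 ≤ b) (hb1 : b < 1)
    (hA : |A - A'| ≤ r) :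
    |((1 - p) * ((1 - b) * A + b * B) + p * C) - ((1 - p) * ((1 - b) * A' + b * B') + p * C')|
      ≤ (1 - p) * ((1 - b) * r + b * |B - B'|) + p * |C - C'| := by
  have e : ((1 - p) * ((1 - b) * A + b * B) + p * C) - ((1 - p) * ((1 - b) * A' + b * B') + p * C')
    = (1 - p) * ((1 - b) * (A - A') + b * (B - B')) + p * (C - C') := by ring
  rw [e]
  have h1 : 0 ≤ 1 - p := by linarith
  have h2 : 0 ≤ 1 - b := by linarith
  calc _ ≤ |(1 - p) * ((1 - b) * (A - A') + b * (B - B'))| + |p * (C - C')| := abs_add_le _ _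
    _ = (1 - p) * |(1 - b) * (A - A') + b * (B - B')| + p * |C - C'| := by
      rw [abs_mul, abs_mul, abs_of_nonneg h1, abs_of_nonneg hp0]
    _ ≤ (1 - p) * (|(1 - b) * (A - A')| + |b * (B - B')|) + p * |C - C'| := by
      gcongr; exact abs_add_le _ _
    _ = (1 - p) * ((1 - b) * |A - A'| + b * |B - B'|) + p * |C - C'| := by
      rw [abs_mul, abs_mul, abs_of_nonneg h2, abs_of_nonneg hb0]
    _ ≤ _ := by gcongr

lemma step_u {m : ℕ} (hm : 2 ≤ m) {p q βu βv : ℕ → ℝ}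
    (hp : ∀ k, p k ∈ Set.Ico (0 : ℝ) 1) (hβu : ∀ k, 0 ≤ βu k ∧ βu k < 1)
    {u v u' v' : List (Fin m) → ℝ} {x : List (Fin m)}
    (h : SolED199At m p q βu βv u v x) (h' : SolED199At m p q βu βv u' v' x) :
    ∃ i, |u x - u' x| ≤ (1 - p x.length) * ((1 - βu x.length) * |u (x ++ [i]) - u' (x ++ [i])|
      + βu x.length * |u x.dropLast - u' x.dropLast|) + p x.length * |v x - v' x| := by
  obtain ⟨i, hi⟩ := mid_diff hm u u' x
  refine ⟨i, ?_⟩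
  have := comb_abs (p x.length) (βu x.length) _ _ (u x.dropLast) (u' x.dropLast) (v x) (v' x) _
    (hp _).1 (hp _).2 (hβu _).1 (hβu _).2 hi
  rw [← h.1, ← h'.1] at this
  exact this

lemma step_v {m : ℕ} (hm : 2 ≤ m) {p q βu βv : ℕ → ℝ}
    (hq : ∀ k, q k ∈ Set.Ico (0 : ℝ) 1) (hβv : ∀ k, 0 ≤ βv k ∧ βv k < 1)
    {u v u' v' : List (Fin m) → ℝ} {x : List (Fin m)}
    (h : SolED199At m p q βu βv u v x) (h' : SolED199At m p q βu βv u' v' x) :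
    ∃ i, |v x - v' x| ≤ (1 - q x.length) * ((1 - βv x.length) * |v (x ++ [i]) - v' (x ++ [i])|
      + βv x.length * |v x.dropLast - v' x.dropLast|) + q x.length * |u x - u' x| := by
  obtain ⟨i, hi⟩ := avg_diff hm v v' x
  refine ⟨i, ?_⟩
  have := comb_abs (q x.length) (βv x.length) _ _ (v x.dropLast) (v' x.dropLast) (u x) (u' x) _
    (hq _).1 (hq _).2 (hβv _).1 (hβv _).2 hi
  rw [← h.2, ← h'.2] at this
  exact this

lemma const_sol {m : ℕ} (hm : 2 ≤ m) (p q βu βv : ℕ → ℝ) (c : ℝ) (x : List (Fin m)) :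
    SolED199At m p q βu βv (fun _ => c) (fun _ => c) x := by
  have : Nonempty (Fin m) := ⟨⟨0, by omega⟩⟩
  have hm0 : (m:ℝ) ≠ 0 := by exact_mod_cast (by omega : m ≠ 0)
  constructor
  · simp [treeMax, treeMin]; ring
  · simp [treeAvg, hm0]; ring

lemma aux_le {s r : ℝ} {p : ℝ} (hp1 : p < 1) (h : s ≤ (1 - p) * r + p * s) : s ≤ r := by
  by_contra! hc
  nlinarith

/-- coupled comparison -/
lemma coupled {m : ℕ} (hm : 2 ≤ m) {p q βu βv : ℕ → ℝ}
    (hp : ∀ k, p k ∈ Set.Ico (0 : ℝ) 1) (hq : ∀ k, q k ∈ Set.Ico (0 : ℝ) 1)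
    (hβu : ∀ k, 0 ≤ βu k ∧ βu k < 1) (hβv : ∀ k, 0 ≤ βv k ∧ βv k < 1)
    {u v u' v' : List (Fin m) → ℝ} (I : Set (List (Fin m))) (N : ℕ) (K : ℝ)
    (hN : ∀ x ∈ I, x.length < N)
    (h : ∀ x ∈ I, SolED199At m p q βu βv u v x) (h' : ∀ x ∈ I, SolED199At m p q βu βv u' v' x)
    (hc : ∀ x ∈ I, ∀ i, x ++ [i] ∉ I →
      |u (x ++ [i]) - u' (x ++ [i])| ≤ K ∧ |v (x ++ [i]) - v' (x ++ [i])| ≤ K)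
    (hd : ∀ x ∈ I, x.dropLast ∉ I →
      |u x.dropLast - u' x.dropLast| ≤ K ∧ |v x.dropLast - v' x.dropLast| ≤ K) :
    ∀ x ∈ I, |u x - u' x| ≤ K ∧ |v x - v' x| ≤ K := by
  have := maxprin (fun x => max |u x - u' x| |v x - v' x| - K) I N hN
    (fun x hx i hi => by have := hc x hx i hi; simp [this.1, this.2])
    (fun x hx hi => by have := hd x hx hi; simp [this.1, this.2])
    (by
      intro x hx _
      rcases le_total |v x - v' x| |u x - u' x| with hle | hle
      · obtain ⟨i, hi⟩ := step_u hm hp hβu (h x hx) (h' x hx)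
        refine ⟨βu x.length, (hβu _).1, (hβu _).2, i, ?_⟩
        have h0 := (hp x.length).1
        have := aux_le (hp x.length).2 (hi.trans (add_le_add le_rfl
          (mul_le_mul_of_nonneg_left hle h0)))
        rw [max_eq_left hle]
        have hb := hβu x.length
        have h1 := mul_le_mul_of_nonneg_left (le_max_left |u (x ++ [i]) - u' (x ++ [i])| |v (x ++ [i]) - v' (x ++ [i])|) (sub_nonneg.2 hb.2.le)
        have h2 := mul_le_mul_of_nonneg_left (le_max_left |u x.dropLast - u' x.dropLast| |v x.dropLast - v' x.dropLast|) hb.1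
        linarith
      · obtain ⟨i, hi⟩ := step_v hm hq hβv (h x hx) (h' x hx)
        refine ⟨βv x.length, (hβv _).1, (hβv _).2, i, ?_⟩
        have h0 := (hq x.length).1
        have := aux_le (hq x.length).2 (hi.trans (add_le_add le_rfl
          (mul_le_mul_of_nonneg_left hle h0)))
        rw [max_eq_right hle]
        have hb := hβv x.length
        have h1 := mul_le_mul_of_nonneg_left (le_max_right |u (x ++ [i]) - u' (x ++ [i])| |v (x ++ [i]) - v' (x ++ [i])|) (sub_nonneg.2 hb.2.le)
        have h2 := mul_le_mul_of_nonneg_left (le_max_right |u x.dropLast - u' x.dropLast| |v x.dropLast - v' x.dropLast|) hb.1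
        linarith)
  intro x hx
  have := this x hx
  simpa using this

/-- scalar comparison with a level barrier -/
lemma scalar {m : ℕ} {p b h : ℕ → ℝ} {n1 : ℕ} {D K : ℝ} (hD : 0 ≤ D) (hK : 0 ≤ K)
    (hp : ∀ k, p k ∈ Set.Ico (0 : ℝ) 1) (hb : ∀ k, 0 ≤ b k ∧ b k < 1)
    (hh0 : ∀ n, n1 ≤ n → 0 ≤ h n)
    (hh : ∀ n, n1 ≤ n → (1 - p (n+1)) * ((1 - b (n+1)) * h (n+2) + b (n+1) * h n) + p (n+1)
      ≤ h (n+1))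
    (w : List (Fin m) → ℝ) (I : Set (List (Fin m))) (N : ℕ)
    (hN : ∀ x ∈ I, x.length < N) (hn1 : ∀ x ∈ I, n1 < x.length)
    (hc : ∀ x ∈ I, ∀ i, x ++ [i] ∉ I → w (x ++ [i]) ≤ K)
    (hd : ∀ x ∈ I, x.dropLast ∉ I → w x.dropLast ≤ K)
    (hw : ∀ x ∈ I, ∃ i, w x ≤ (1 - p x.length) * ((1 - b x.length) * w (x ++ [i])
      + b x.length * w x.dropLast) + p x.length * D) :
    ∀ x ∈ I, w x ≤ K + D * h x.length := by
  have := maxprin (fun x => w x - K - D * h x.length) I N hN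
    (fun x hx i hi => by
      have := hc x hx i hi
      have := mul_nonneg hD (hh0 (x ++ [i]).length (by have := hn1 x hx; simp; omega))
      linarith)
    (fun x hx hi => by
      have := hd x hx hi
      have := mul_nonneg hD (hh0 (x.dropLast).length (by have := hn1 x hx; simp; omega))
      linarith)
    (by
      intro x hx hpos
      obtain ⟨i, hi⟩ := hw x hx
      refine ⟨b x.length, (hb _).1, (hb _).2, i, ?_⟩
      obtain ⟨n, hn⟩ : ∃ n, x.length = n + 1 := ⟨x.length - 1, by have := hn1 x hx; omega⟩
      have hn' : n1 ≤ n := by have := hn1 x hx; omega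
      simp only [List.length_append, List.length_dropLast, List.length_singleton, hn,
        Nat.add_sub_cancel] at hi hpos ⊢
      have k1 := mul_le_mul_of_nonneg_left (hh n hn') hD
      have hp' := hp (n+1)
      have k2 : 0 ≤ p (n+1) * K := mul_nonneg hp'.1 hK
      set R := (1 - b (n+1)) * (w (x ++ [i]) - K - D * h (n+1+1)) +
        b (n+1) * (w x.dropLast - K - D * h n) with hR
      have k3 : w x - K - D * h (n+1) ≤ (1 - p (n+1)) * R := by
        have e : (1 - p (n+1)) * R = (1 - p (n+1)) * ((1 - b (n+1)) * w (x ++ [i])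
          + b (n+1) * w x.dropLast) + p (n+1) * D - K + p (n+1) * K -
          D * ((1 - p (n+1)) * ((1 - b (n+1)) * h (n+2) + b (n+1) * h n) + p (n+1)) := by
          rw [hR]; ring
        rw [e]; linarith
      by_contra! hcon
      nlinarith [hp'.1, hp'.2])
  intro x hx
  linarith [this x hx]

/-- a barrier from averaged sequences -/
lemma barrier {p b a e : ℕ → ℝ} {F G : ℝ} (k : ℕ) (hp : ∀ k, p k ∈ Set.Ico (0 : ℝ) 1)
    (ha : Tendsto a atTop (𝓝 F)) (he : Tendsto e atTop (𝓝 G)) (hFG : F ≠ G)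
    (hrec : ∀ n, k ≤ n → a (n+1) = (1 - p (n+1)) * ((1 - b (n+1)) * a (n+2) + b (n+1) * a n)
      + p (n+1) * e (n+1)) (ε : ℝ) (hε : 0 < ε) :
    ∃ (n1 : ℕ) (h : ℕ → ℝ), (∀ n, n1 ≤ n → 0 ≤ h n ∧ h n ≤ ε) ∧
      (∀ n, n1 ≤ n → (1 - p (n+1)) * ((1 - b (n+1)) * h (n+2) + b (n+1) * h n) + p (n+1)
      ≤ h (n+1)) := by
  have hFG' : F - G ≠ 0 := sub_ne_zero.2 hFG
  set s := 2 / (F - G) with hs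
  have t1 : Tendsto (fun n => (F - a n) * s + ε / 2) atTop (𝓝 ((F - F) * s + ε / 2)) :=
    ((tendsto_const_nhds.sub ha).mul_const s).add_const _
  have t2 : Tendsto (fun n => (F - e n) * s) atTop (𝓝 ((F - G) * s)) :=
    ((tendsto_const_nhds.sub he).mul_const s)
  have e2 : (F - G) * s = 2 := by rw [hs]; field_simp
  rw [e2] at t2
  have e1 : (F - F) * s + ε / 2 = ε / 2 := by ring
  rw [e1] at t1
  have ev := ((t1.eventually (Icc_mem_nhds (by linarith : 0 < ε / 2) (by linarith : ε / 2 < ε))).and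
    (t2.eventually (lt_mem_nhds (by norm_num : (1:ℝ) < 2)))).and (eventually_ge_atTop k)
  obtain ⟨n1, hn1⟩ := eventually_atTop.1 ev
  refine ⟨n1, fun n => (F - a n) * s + ε / 2, fun n hn => (hn1 n hn).1.1, fun n hn => ?_⟩
  have r := hrec n (hn1 n hn).2
  have g := (hn1 (n+1) (by omega)).1.2
  have hp' := hp (n+1)
  have g1 := mul_le_mul_of_nonneg_left g.le hp'.1
  have g2 := mul_nonneg hp'.1 hε.le
  have : (F - a (n+1)) * s + ε / 2 = (1 - p (n+1)) * ((1 - b (n+1)) * ((F - a (n+2)) * s + ε / 2)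
    + b (n+1) * ((F - a n) * s + ε / 2)) + p (n+1) * ((F - e (n+1)) * s) + p (n+1) * (ε / 2) := by
    rw [r]; ring
  simp only
  rw [this]; linarith

lemma psiVertex_append {m : ℕ} (x : List (Fin m)) (i : Fin m) :
    psiVertex m (x ++ [i]) = psiVertex m x + (i : ℝ) / (m : ℝ) ^ (x.length + 1) := by
  have key : ∀ y : List (Fin m), psiVertex m y =
      ∑ j ∈ Finset.range y.length, (if h : j < y.length then ((y[j] : Fin m) : ℝ) else 0) / (m:ℝ)^(j+1) := by
    intro y
    rw [Finset.sum_range]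
    simp [psiVertex]
  have hl : (x ++ [i]).length = x.length + 1 := by simp
  have hr : Finset.range (x ++ [i]).length = Finset.range (x.length + 1) := by rw [hl]
  rw [key, key, hr, Finset.sum_range_succ]
  congr 1
  · apply Finset.sum_congr rfl
    intro j hj
    have hj := Finset.mem_range.1 hj
    have : j < x.length + 1 := by omega
    simp [hj, List.getElem_append_left hj, this]
  · simp

lemma psiVertex_bd {m : ℕ} (hm : 2 ≤ m) (z s : List (Fin m)) :
    psiVertex m z ≤ psiVertex m (z ++ s) ∧
      psiVertex m (z ++ s) ≤ psiVertex m z + (1 / (m:ℝ)^z.length - 1 / (m:ℝ)^(z ++ s).length) := by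
  have hm0 : (0:ℝ) < m := by exact_mod_cast (by omega : 0 < m)
  induction s using List.reverseRecOn with
  | nil => simp
  | append_singleton s i ih =>
    rw [← List.append_assoc, psiVertex_append]
    have h1 : (0:ℝ) ≤ (i:ℝ) / (m:ℝ)^((z++s).length+1) := by positivity
    have h2 : (i:ℝ) / (m:ℝ)^((z++s).length+1) ≤ 1 / (m:ℝ)^(z++s).length - 1 / (m:ℝ)^((z++s).length+1) := by
      have : (i:ℝ) + 1 ≤ m := by exact_mod_cast i.2
      rw [pow_succ, div_le_iff₀ (by positivity)]
      field_simp
      linarith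
    have e : (z ++ s ++ [i]).length = (z++s).length + 1 := by simp; omega
    rw [e]
    constructor
    · linarith [ih.1]
    · linarith [ih.2]

lemma psiVertex_prefix {m : ℕ} (hm : 2 ≤ m) {z y : List (Fin m)} (h : z <+: y) :
    |psiVertex m y - psiVertex m z| ≤ 1 / (m:ℝ)^z.length := by
  obtain ⟨s, rfl⟩ := h
  have hm0 : (0:ℝ) < m := by exact_mod_cast (by omega : 0 < m)
  have := psiVertex_bd hm z s
  have h3 : 0 ≤ 1 / (m:ℝ)^(z ++ s).length := by positivity
  rw [abs_le]; constructor
  · have : 0 ≤ 1 / (m:ℝ)^z.length := by positivity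
    linarith
  · linarith

lemma psiVertex_mem {m : ℕ} (hm : 2 ≤ m) (x : List (Fin m)) : psiVertex m x ∈ Set.Icc (0:ℝ) 1 := by
  have := psiVertex_bd hm [] x
  have hm0 : (0:ℝ) < m := by exact_mod_cast (by omega : 0 < m)
  have h3 : 0 ≤ 1 / (m:ℝ)^([] ++ x).length := by positivity
  have h0 : psiVertex m [] = 0 := by simp [psiVertex]
  simp only [h0, List.nil_append, List.length_nil, pow_zero] at this h3
  constructor
  · exact this.1
  · linarith [this.2]

lemma psiVertex_trunc {m : ℕ} (π : ℕ → Fin m) (n : ℕ) :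
    psiVertex m (trunc π n) = ∑ k ∈ Finset.range n, (π k : ℝ) / (m : ℝ) ^ (k + 1) := by
  induction n with
  | zero => rfl
  | succ n ih => rw [trunc_succ, psiVertex_append, ih, Finset.sum_range_succ, trunc_length]

lemma psi_tendsto {m : ℕ} (hm : 2 ≤ m) (π : ℕ → Fin m) :
    Tendsto (fun n => psiVertex m (trunc π n)) atTop (𝓝 (psi m π)) := by
  simp_rw [psiVertex_trunc]
  have hm0 : (0:ℝ) < m := by exact_mod_cast (by omega : 0 < m)
  have : Summable fun k => (π k : ℝ) / (m : ℝ) ^ (k + 1) :=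
    summable_of_sum_range_le (c := 1) (fun n => by positivity) (fun n => by
      rw [← psiVertex_trunc]; exact (psiVertex_mem hm _).2)
  exact this.hasSum.tendsto_sum_nat

lemma psi_mem {m : ℕ} (hm : 2 ≤ m) (π : ℕ → Fin m) : psi m π ∈ Set.Icc (0:ℝ) 1 :=
  isClosed_Icc.mem_of_tendsto (psi_tendsto hm π) (Eventually.of_forall fun _ => psiVertex_mem hm _)

lemma trunc_prefix {m : ℕ} (π : ℕ → Fin m) {k n : ℕ} (h : k ≤ n) : trunc π k <+: trunc π n := by
  induction n, h using Nat.le_induction with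
  | base => exact List.prefix_rfl
  | succ n _ ih => rw [trunc_succ]; exact ih.trans (List.prefix_append _ _)

lemma psi_trunc {m : ℕ} (hm : 2 ≤ m) (π : ℕ → Fin m) (k : ℕ) :
    |psi m π - psiVertex m (trunc π k)| ≤ 1 / (m:ℝ)^k := by
  have := ((psi_tendsto hm π).sub_const (psiVertex m (trunc π k))).abs
  refine le_of_tendsto this ?_
  filter_upwards [eventually_ge_atTop k] with n hn
  have := psiVertex_prefix hm (trunc_prefix π hn)
  rwa [trunc_length] at this

lemma f_tendsto {m : ℕ} (hm : 2 ≤ m) (π : ℕ → Fin m) {f : ℝ → ℝ} (hf : ContinuousOn f (Set.Icc 0 1)) :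
    Tendsto (fun n => f (psiVertex m (trunc π n))) atTop (𝓝 (f (psi m π))) :=
  (hf _ (psi_mem hm π)).tendsto.comp (tendsto_nhdsWithin_iff.2
    ⟨psi_tendsto hm π, Eventually.of_forall fun _ => psiVertex_mem hm _⟩)

lemma osc {m : ℕ} (hm : 2 ≤ m) {f : ℝ → ℝ} (hf : ContinuousOn f (Set.Icc 0 1)) {ε : ℝ} (hε : 0 < ε) :
    ∃ n0 : ℕ, ∀ n, n0 ≤ n → ∀ a ∈ Set.Icc (0:ℝ) 1, ∀ b ∈ Set.Icc (0:ℝ) 1,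
      |a - b| ≤ 1 / (m:ℝ)^n → |f a - f b| ≤ ε := by
  have hu := isCompact_Icc.uniformContinuousOn_of_continuous hf
  obtain ⟨δ, hδ, h⟩ := Metric.uniformContinuousOn_iff.1 hu ε hε
  have hm1 : (1:ℝ) < m := by exact_mod_cast (by omega : 1 < m)
  have ht : Tendsto (fun n : ℕ => 1 / (m:ℝ)^n) atTop (𝓝 0) := by
    simpa [one_div, Function.comp_def] using tendsto_inv_atTop_zero.comp (tendsto_pow_atTop_atTop_of_one_lt hm1)
  obtain ⟨n0, hn0⟩ := eventually_atTop.1 (ht.eventually (gt_mem_nhds hδ))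
  refine ⟨n0, fun n hn a ha b hb hab => ?_⟩
  exact (h a ha b hb (hab.trans_lt (hn0 n hn))).le

section avg
open MeasureTheory ProbabilityTheory

def pathX {m : ℕ} {ι : Type} (sel : List (Fin m) → ι → Fin m) (ω : ℕ → ι) : ℕ → List (Fin m)
  | 0 => []
  | n+1 => pathX sel ω n ++ [sel (pathX sel ω n) (ω n)]

lemma pathX_length {m : ℕ} {ι : Type} (sel : List (Fin m) → ι → Fin m) (ω : ℕ → ι) (n : ℕ) :
    (pathX sel ω n).length = n := by
  induction n with
  | zero => rfl
  | succ n ih => simp [pathX, ih]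

lemma pathX_congr {m : ℕ} {ι : Type} (sel : List (Fin m) → ι → Fin m) (ω ω' : ℕ → ι) (n : ℕ)
    (h : ∀ i < n, ω i = ω' i) : pathX sel ω n = pathX sel ω' n := by
  induction n with
  | zero => rfl
  | succ n ih => 
    have := ih fun i hi => h i (by omega)
    simp only [pathX, this, h n (by omega)]

lemma pathX_trunc {m : ℕ} {ι : Type} (sel : List (Fin m) → ι → Fin m) (ω : ℕ → ι) (n : ℕ) :
    trunc (fun j => sel (pathX sel ω j) (ω j)) n = pathX sel ω n := by
  induction n with
  | zero => rfl
  | succ n ih => rw [trunc_succ, ih]; rfl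

lemma exists_avg {m : ℕ} {ι : Type} [Fintype ι] [Nonempty ι]
    (sel : List (Fin m) → ι → Fin m) :
    ∃ E : ℕ → (List (Fin m) → ℝ) → ℝ,
      (∀ n φ χ (a b : ℝ), E n (fun x => a * φ x + b * χ x) = a * E n φ + b * E n χ) ∧
      (∀ n φ χ, (∀ x, x.length = n → φ x = χ x) → E n φ = E n χ) ∧
      (∀ n φ, E (n+1) φ = E n (fun x => (1 / (Fintype.card ι : ℝ)) * ∑ i, φ (x ++ [sel x i]))) ∧
      (∀ n φ, E (n+1) (fun x => φ x.dropLast) = E n φ) ∧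
      (∀ (φ : List (Fin m) → ℝ) (D η : ℝ) (l : (ℕ → Fin m) → ℝ), (∀ x, |φ x| ≤ D) →
        (∀ π : ℕ → Fin m, (∀ n, ∃ i, π n = sel (trunc π n) i) →
          Tendsto (fun n => φ (trunc π n)) atTop (𝓝 (l π)) ∧ η ≤ l π) →
        ∃ F, Tendsto (fun n => E n φ) atTop (𝓝 F) ∧ η ≤ F) := by
  classical
  let : MeasurableSpace ι := ⊤
  have : DiscreteMeasurableSpace ι := ⟨fun _ => trivial⟩
  let : MeasurableSpace (List (Fin m)) := ⊤
  have : DiscreteMeasurableSpace (List (Fin m)) := ⟨fun _ => trivial⟩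
  let ν : Measure ι := (PMF.uniformOfFintype ι).toMeasure
  have hν : ∀ g : ι → ℝ, ∫ i, g i ∂ν = (1 / (Fintype.card ι : ℝ)) * ∑ i, g i := by
    intro g
    rw [PMF.integral_eq_sum]
    simp [Finset.mul_sum]
  let P : Measure (ℕ → ι) := Measure.infinitePi (fun _ : ℕ => ν)
  have hX : ∀ n, Measurable (fun ω : ℕ → ι => pathX sel ω n) := by
    intro n
    induction n with
    | zero => exact measurable_const
    | succ n ih =>
      have : Measurable (fun z : List (Fin m) × ι => z.1 ++ [sel z.1 z.2]) := Measurable.of_discrete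
      exact this.comp (ih.prodMk (measurable_pi_apply n))
  have hM : ∀ n (φ : List (Fin m) → ℝ), Measurable (fun ω : ℕ → ι => φ (pathX sel ω n)) :=
    fun n φ => (Measurable.of_discrete (f := φ)).comp (hX n)
  have hbd : ∀ n (φ : List (Fin m) → ℝ), ∃ C, ∀ x : List (Fin m), x.length = n → |φ x| ≤ C := by
    intro n φ
    have hf : {x : List (Fin m) | x.length = n}.Finite := List.finite_length_eq (Fin m) n
    obtain ⟨C, hC⟩ := (hf.image fun x => |φ x|).bddAbove
    exact ⟨C, fun x hx => hC ⟨x, hx, rfl⟩⟩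
  have hint : ∀ n (φ : List (Fin m) → ℝ), Integrable (fun ω : ℕ → ι => φ (pathX sel ω n)) P := by
    intro n φ
    obtain ⟨C, hC⟩ := hbd n φ
    exact Integrable.of_bound (hM n φ).aestronglyMeasurable C
      (Eventually.of_forall fun ω => hC _ (pathX_length sel ω n))
  refine ⟨fun n φ => ∫ ω, φ (pathX sel ω n) ∂P, ?_, ?_, ?_, ?_, ?_⟩
  · intro n φ χ a b
    simp only
    rw [integral_add ((hint n φ).const_mul a) ((hint n χ).const_mul b), integral_const_mul, integral_const_mul]
  · intro n φ χ h
    exact integral_congr_ae (Eventually.of_forall fun ω => h _ (pathX_length sel ω n))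
  · intro n φ
    have hind : IndepFun (fun ω : ℕ → ι => pathX sel ω n) (fun ω : ℕ → ι => ω n) P := by
      have h1 : iIndepFun (fun (i : ℕ) (ω : ℕ → ι) => ω i) P :=
        iIndepFun_infinitePi (P := fun _ : ℕ => ν) (X := fun _ x => x) (fun _ => measurable_id)
      have h2 := h1.indepFun_finset (Finset.range n) {n} (by simp) (fun i => measurable_pi_apply i)
      let d : ι := Classical.arbitrary ι
      have h3 := h2.comp (φ := fun r : (Finset.range n → ι) =>
          pathX sel (fun i => if h : i ∈ Finset.range n then r ⟨i, h⟩ else d) n)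
        (ψ := fun r => r ⟨n, by simp⟩) (measurable_of_countable _) (measurable_of_countable _)
      refine h3.congr (Eventually.of_forall fun ω => ?_) (Eventually.of_forall fun ω => rfl)
      simp only [Function.comp]
      apply pathX_congr
      intro i hi
      simp [hi]
    have hmap := (indepFun_iff_map_prod_eq_prod_map_map (hX n).aemeasurable
      (measurable_pi_apply n).aemeasurable).1 hind
    have hmapn : P.map (fun ω : ℕ → ι => ω n) = ν := Measure.infinitePi_map_eval (fun _ : ℕ => ν) n
    rw [hmapn] at hmap
    let Ψ : List (Fin m) × ι → ℝ := fun z => φ (z.1 ++ [sel z.1 z.2])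
    have hΨ : Measurable Ψ := Measurable.of_discrete
    have hp : Measurable (fun ω : ℕ → ι => (pathX sel ω n, ω n)) := (hX n).prodMk (measurable_pi_apply n)
    have : IsProbabilityMeasure (P.map (fun ω : ℕ → ι => pathX sel ω n)) :=
      Measure.isProbabilityMeasure_map (hX n).aemeasurable
    calc ∫ ω, φ (pathX sel ω (n+1)) ∂P = ∫ ω, Ψ (pathX sel ω n, ω n) ∂P := rfl
      _ = ∫ z, Ψ z ∂(P.map fun ω => (pathX sel ω n, ω n)) :=
        (integral_map hp.aemeasurable hΨ.aestronglyMeasurable).symm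
      _ = ∫ x, ∫ i, Ψ (x, i) ∂ν ∂(P.map fun ω => pathX sel ω n) := by
        rw [hmap, integral_prod]
        rw [← hmap]
        exact (integrable_map_measure hΨ.aestronglyMeasurable hp.aemeasurable).2 (hint (n+1) φ)
      _ = ∫ ω, ∫ i, Ψ (pathX sel ω n, i) ∂ν ∂P :=
        integral_map (hX n).aemeasurable (Measurable.of_discrete).aestronglyMeasurable
      _ = _ := by simp_rw [hν]; rfl
  · intro n φ
    simp [pathX]
  · intro φ D η l hD hl
    let br : (ℕ → ι) → ℕ → Fin m := fun ω j => sel (pathX sel ω j) (ω j)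
    have hbr : ∀ ω, Tendsto (fun n => φ (pathX sel ω n)) atTop (𝓝 (l (br ω))) ∧ η ≤ l (br ω) := by
      intro ω
      have := hl (br ω) (fun n => ⟨ω n, by rw [pathX_trunc]⟩)
      simpa only [br, pathX_trunc] using this
    refine ⟨∫ ω, l (br ω) ∂P, ?_, ?_⟩
    · exact tendsto_integral_of_dominated_convergence (fun _ => D)
        (fun n => (hM n φ).aestronglyMeasurable) (integrable_const D)
        (fun n => Eventually.of_forall fun ω => hD _) (Eventually.of_forall fun ω => (hbr ω).1)
    · have hi : Integrable (fun ω => l (br ω)) P :=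
        Integrable.of_bound (aestronglyMeasurable_of_tendsto_ae atTop
          (fun n => (hM n φ).aestronglyMeasurable) (Eventually.of_forall fun ω => (hbr ω).1)) D
          (Eventually.of_forall fun ω => le_of_tendsto (hbr ω).1.abs (Eventually.of_forall fun n => hD _))
      have := integral_mono (integrable_const η) hi (fun ω => (hbr ω).2)
      simpa using this
end avg

lemma geom {m : ℕ} (hm : 2 ≤ m) (Q : List (Fin m) → Prop)
    (hQ : ∀ π : ℕ → Fin m, ∀ᶠ n in atTop, Q (trunc π n)) (n0 : ℕ) :
    ∃ N, ∀ x : List (Fin m), N ≤ x.length → ∃ (z : List (Fin m)) (I : Set (List (Fin m))) (M : ℕ),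
      z <+: x ∧ n0 ≤ z.length ∧ Q z ∧ x ∈ I ∧
      (∀ y ∈ I, z <+: y ∧ z.length < y.length ∧ y.length < M) ∧
      (∀ y ∈ I, ∀ i, y ++ [i] ∉ I → Q (y ++ [i])) ∧
      (∀ y ∈ I, y.dropLast ∉ I → Q y.dropLast ∧ z <+: y.dropLast) := by
  have fan' : ∀ K, ∃ N, ∀ x : List (Fin m), N ≤ x.length →
      ∃ z, z <+: x ∧ z.length ≤ N ∧ K ≤ z.length ∧ Q z := fun K => fan hm _ fun π =>
    (((hQ π).and (eventually_ge_atTop K)).exists).imp fun n hn => ⟨by rw [trunc_length]; exact hn.2, hn.1⟩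
  obtain ⟨N, hN⟩ := fan' n0
  refine ⟨N + 1, fun x hx => ?_⟩
  obtain ⟨z, hzx, hzN, hz0, hzQ⟩ := hN x (by omega)
  obtain ⟨M, hM⟩ := fan' (x.length + 1)
  refine ⟨z, {y | z <+: y ∧ z.length < y.length ∧ ∀ z', z' <+: y → x.length < z'.length → ¬ Q z'},
    M, hzx, hz0, hzQ, ⟨hzx, by omega, fun z' h1 h2 => ?_⟩, ?_, ?_, ?_⟩
  · have := h1.length_le; omega
  · rintro y ⟨h1, h2, h3⟩
    refine ⟨h1, h2, ?_⟩
    by_contra! hc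
    obtain ⟨z', a, _, b, c⟩ := hM y hc
    exact h3 z' a (by omega) c
  · rintro y ⟨h1, h2, h3⟩ i hi
    by_contra hq
    refine hi ⟨h1.trans (List.prefix_append _ _), by simp; omega, fun z' a b => ?_⟩
    rcases List.prefix_concat_iff.1 a with rfl | a
    · exact hq
    · exact h3 z' a b
  · rintro y ⟨h1, h2, h3⟩ hi
    rcases List.eq_nil_or_concat y with rfl | ⟨y', a, rfl⟩
    · simp at h2
    rw [List.concat_eq_append] at *
    simp only [List.dropLast_concat] at hi ⊢
    rcases List.prefix_concat_iff.1 h1 with rfl | h1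
    · simp at h2
    refine ⟨?_, h1⟩
    by_cases hl : z.length < y'.length
    · exact absurd ⟨h1, hl, fun z' a b => h3 z' (a.trans (List.prefix_append _ _)) b⟩ hi
    · have := h1.length_le
      rw [← h1.eq_of_length (by omega)]; exact hzQ

lemma good_ev {m : ℕ} (hm : 2 ≤ m) {f g : ℝ → ℝ}
    (hf : ContinuousOn f (Set.Icc 0 1)) (hg : ContinuousOn g (Set.Icc 0 1))
    {u v : List (Fin m) → ℝ} (hb : BoundaryCond m f g u v) {ε : ℝ} (hε : 0 < ε) (π : ℕ → Fin m) :
    ∀ᶠ n in atTop, |u (trunc π n) - f (psiVertex m (trunc π n))| ≤ ε ∧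
      |v (trunc π n) - g (psiVertex m (trunc π n))| ≤ ε := by
  have t1 := ((hb π).1.sub (f_tendsto hm π hf)).abs
  have t2 := ((hb π).2.sub (f_tendsto hm π hg)).abs
  rw [sub_self, abs_zero] at t1 t2
  filter_upwards [t1.eventually (gt_mem_nhds hε), t2.eventually (gt_mem_nhds hε)] with n a b
  exact ⟨a.le, b.le⟩

lemma fbound {f : ℝ → ℝ} (hf : ContinuousOn f (Set.Icc 0 1)) :
    ∃ C, ∀ t ∈ Set.Icc (0:ℝ) 1, |f t| ≤ C := isCompact_Icc.exists_bound_of_continuousOn hf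

lemma bounded {m : ℕ} (hm : 2 ≤ m) {p q βu βv : ℕ → ℝ}
    (hp : ∀ k, p k ∈ Set.Ico (0 : ℝ) 1) (hq : ∀ k, q k ∈ Set.Ico (0 : ℝ) 1)
    (hβu : ∀ k, 0 ≤ βu k ∧ βu k < 1) (hβv : ∀ k, 0 ≤ βv k ∧ βv k < 1) {f g : ℝ → ℝ}
    (hf : ContinuousOn f (Set.Icc 0 1)) (hg : ContinuousOn g (Set.Icc 0 1))
    {u v : List (Fin m) → ℝ} (hsol : ∀ x, SolED199At m p q βu βv u v x)
    (hb : BoundaryCond m f g u v) : ∃ D, ∀ x, |u x| ≤ D ∧ |v x| ≤ D := by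
  obtain ⟨C1, h1⟩ := fbound hf
  obtain ⟨C2, h2⟩ := fbound hg
  set K := max C1 C2 + 1
  obtain ⟨N, hN⟩ := geom hm (fun x => |u x| ≤ K ∧ |v x| ≤ K) (fun π => by
    filter_upwards [good_ev hm hf hg hb one_pos π] with n hn
    have a := h1 _ (psiVertex_mem hm (trunc π n))
    have b := h2 _ (psiVertex_mem hm (trunc π n))
    have e1 := abs_sub_abs_le_abs_sub (u (trunc π n)) (f (psiVertex m (trunc π n)))
    have e2 := abs_sub_abs_le_abs_sub (v (trunc π n)) (g (psiVertex m (trunc π n)))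
    have := le_max_left C1 C2
    have := le_max_right C1 C2
    constructor <;> simp only [K] <;> linarith [hn.1, hn.2]) 0
  have hfin : {x : List (Fin m) | x.length < N}.Finite := List.finite_length_lt (Fin m) N
  obtain ⟨B, hB⟩ := (hfin.image fun x => max |u x| |v x|).bddAbove
  refine ⟨max B K, fun x => ?_⟩
  by_cases hx : x.length < N
  · have := hB ⟨x, hx, rfl⟩
    simp only [max_le_iff] at this
    exact ⟨this.1.trans (le_max_left _ _), this.2.trans (le_max_left _ _)⟩
  · obtain ⟨z, I, M, _, _, _, hxI, hI, hc, hd⟩ := hN x (by omega)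
    have := coupled hm hp hq hβu hβv (u := u) (v := v) (u' := fun _ => 0) (v' := fun _ => 0) I M K
      (fun y hy => (hI y hy).2.2) (fun y _ => hsol y) (fun y _ => const_sol hm p q βu βv 0 y)
      (fun y hy i hi => by simpa using hc y hy i hi) (fun y hy hi => by simpa using (hd y hy hi).1) x hxI
    simp only [sub_zero] at this
    exact ⟨this.1.trans (le_max_right _ _), this.2.trans (le_max_right _ _)⟩

lemma avg_barrier {m : ℕ} {ι : Type} [Fintype ι] [Nonempty ι] (sel' : List (Fin m) → ι → Fin m)
    {w w' : List (Fin m) → ℝ} {D : ℝ} (hD : ∀ x, |w x| ≤ D ∧ |w' x| ≤ D)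
    {l l' : (ℕ → Fin m) → ℝ}
    (hl : ∀ π, Tendsto (fun n => w (trunc π n)) atTop (𝓝 (l π)))
    (hl' : ∀ π, Tendsto (fun n => w' (trunc π n)) atTop (𝓝 (l' π)))
    (x1 : List (Fin m)) (η s : ℝ) (hη : 0 < η)
    (hs : ∀ π, trunc π x1.length = x1 → η ≤ s * (l π - l' π))
    {p b : ℕ → ℝ} (hp : ∀ k, p k ∈ Set.Ico (0 : ℝ) 1)
    (heq : ∀ x, w x = (1 - p x.length) * ((1 - b x.length) *
      ((1 / (Fintype.card ι : ℝ)) * ∑ i, w (x ++ [sel' x i])) + b x.length * w x.dropLast)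
      + p x.length * w' x) (ε : ℝ) (hε : 0 < ε) :
    ∃ (n1 : ℕ) (h : ℕ → ℝ), (∀ n, n1 ≤ n → 0 ≤ h n ∧ h n ≤ ε) ∧
      (∀ n, n1 ≤ n → (1 - p (n+1)) * ((1 - b (n+1)) * h (n+2) + b (n+1) * h n) + p (n+1)
      ≤ h (n+1)) := by
  let sel : List (Fin m) → ι → Fin m := fun x i =>
    if h : x.length < x1.length then x1[x.length] else sel' x i
  have hcons : ∀ π : ℕ → Fin m, (∀ n, ∃ i, π n = sel (trunc π n) i) → trunc π x1.length = x1 := by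
    intro π hπ
    have : ∀ n, n ≤ x1.length → trunc π n = x1.take n := by
      intro n
      induction n with
      | zero => intro _; simp [trunc]
      | succ n ih =>
        intro hn
        obtain ⟨i, hi⟩ := hπ n
        have hlt : n < x1.length := by omega
        rw [trunc_succ, hi, ih (by omega)]
        have hl2 : (x1.take n).length = n := by simp; omega
        simp only [sel, hl2, hlt, dif_pos]
        exact List.take_append_getElem hlt
    simpa using this _ le_rfl
  obtain ⟨E, lin, cong, step, drop, lim⟩ := exists_avg sel
  have lb : ∀ (w : List (Fin m) → ℝ) (hw : ∀ x, |w x| ≤ D) (l : (ℕ → Fin m) → ℝ),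
      (∀ π, Tendsto (fun n => w (trunc π n)) atTop (𝓝 (l π))) →
      ∃ F, Tendsto (fun n => E n w) atTop (𝓝 F) := fun w hw l h => by
    obtain ⟨F, hF, _⟩ := lim w D (-D) l hw (fun π _ => ⟨h π,
      ge_of_tendsto (h π) (Eventually.of_forall fun n => (abs_le.1 (hw _)).1)⟩)
    exact ⟨F, hF⟩
  obtain ⟨F, hF⟩ := lb w (fun x => (hD x).1) l hl
  obtain ⟨G, hG⟩ := lb w' (fun x => (hD x).2) l' hl'
  obtain ⟨H, hH, hHη⟩ := lim (fun x => s * w x + (-s) * w' x) (|s| * D + |s| * D) η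
    (fun π => s * (l π - l' π))
    (fun x => by
      refine (abs_add_le _ _).trans ?_
      rw [abs_mul, abs_mul, abs_neg]
      have := hD x
      gcongr
      · exact this.1
      · exact this.2)
    (fun π hπ => ⟨by
      have := ((hl π).const_mul s).add ((hl' π).const_mul (-s))
      convert this using 2
      ring, hs π (hcons π hπ)⟩)
  have hH2 : Tendsto (fun n => E n (fun x => s * w x + (-s) * w' x)) atTop (𝓝 (s * F + (-s) * G)) := by
    simp_rw [lin]
    exact (hF.const_mul s).add (hG.const_mul (-s))
  have hHe := tendsto_nhds_unique hH hH2
  have hFG : F ≠ G := by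
    rintro rfl
    have : H = 0 := by rw [hHe]; ring
    linarith
  refine barrier (a := fun n => E n w) (e := fun n => E n w') x1.length hp hF hG hFG ?_ ε hε
  intro n hn
  have e1 := cong (n+1) w (fun x => ((1 - p (n+1)) * (1 - b (n+1))) *
      ((1 / (Fintype.card ι : ℝ)) * ∑ i, w (x ++ [sel x i])) +
      1 * (((1 - p (n+1)) * b (n+1)) * w x.dropLast + p (n+1) * w' x)) (fun x hx => by
    have hsx : ∀ i, sel x i = sel' x i := fun i => by
      have : ¬ x.length < x1.length := by omega
      simp [sel, this]
    simp only [hsx]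
    conv_lhs => rw [heq x, hx]
    ring)
  rw [e1, lin, lin, ← step, drop]
  ring

lemma two_barriers {m : ℕ} (hm : 2 ≤ m) {p q βu βv : ℕ → ℝ}
    (hp : ∀ k, p k ∈ Set.Ico (0 : ℝ) 1) (hq : ∀ k, q k ∈ Set.Ico (0 : ℝ) 1) {f g : ℝ → ℝ}
    (hf : ContinuousOn f (Set.Icc 0 1)) (hg : ContinuousOn g (Set.Icc 0 1))
    {u v : List (Fin m) → ℝ} (hsol : ∀ x, SolED199At m p q βu βv u v x)
    (hb : BoundaryCond m f g u v) {D : ℝ} (hD : ∀ x, |u x| ≤ D ∧ |v x| ≤ D)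
    (x0 : List (Fin m)) (hx0 : f (psiVertex m x0) ≠ g (psiVertex m x0)) (ε : ℝ) (hε : 0 < ε) :
    (∃ (n1 : ℕ) (h : ℕ → ℝ), (∀ n, n1 ≤ n → 0 ≤ h n ∧ h n ≤ ε) ∧
      (∀ n, n1 ≤ n → (1 - p (n+1)) * ((1 - βu (n+1)) * h (n+2) + βu (n+1) * h n) + p (n+1)
      ≤ h (n+1))) ∧
    (∃ (n1 : ℕ) (h : ℕ → ℝ), (∀ n, n1 ≤ n → 0 ≤ h n ∧ h n ≤ ε) ∧
      (∀ n, n1 ≤ n → (1 - q (n+1)) * ((1 - βv (n+1)) * h (n+2) + βv (n+1) * h n) + q (n+1)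
      ≤ h (n+1))) := by
  have : Nonempty (Fin m) := ⟨⟨0, by omega⟩⟩
  have hm0 : 0 < m := by omega
  set t := psiVertex m x0
  have hd : f t - g t ≠ 0 := sub_ne_zero.2 hx0
  set η := |f t - g t| / 2 with hη
  have hηpos : 0 < η := by positivity
  obtain ⟨n0, hn0⟩ := osc hm (hf.sub hg) hηpos
  obtain ⟨x1, hx1l, hx1t⟩ : ∃ x1 : List (Fin m), n0 ≤ x1.length ∧ psiVertex m x1 = t := by
    have : ∀ n, ∃ x1 : List (Fin m), n ≤ x1.length ∧ psiVertex m x1 = t := by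
      intro n
      induction n with
      | zero => exact ⟨x0, by omega, rfl⟩
      | succ n ih =>
        obtain ⟨y, h1, h2⟩ := ih
        exact ⟨y ++ [⟨0, hm0⟩], by simp; omega, by rw [psiVertex_append, h2]; simp⟩
    exact this n0
  obtain ⟨s, hs⟩ : ∃ s : ℝ, (s = 1 ∨ s = -1) ∧ s * (f t - g t) = |f t - g t| := by
    rcases abs_cases (f t - g t) with h | h
    · exact ⟨1, Or.inl rfl, by rw [h.1]; ring⟩
    · exact ⟨-1, Or.inr rfl, by rw [h.1]; ring⟩
  have key : ∀ π, trunc π x1.length = x1 → η ≤ s * (f (psi m π) - g (psi m π)) := by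
    intro π hπ
    have h1 := psi_trunc hm π x1.length
    rw [hπ, hx1t] at h1
    have h2 := hn0 _ hx1l _ (psi_mem hm π) t (psiVertex_mem hm x0) h1
    simp only [Pi.sub_apply] at h2
    have h3 := abs_le.1 h2
    rcases hs with ⟨rfl | rfl, hs2⟩ <;> linarith
  have selmax : ∀ x : List (Fin m), ∃ i, treeMax m u x = u (x ++ [i]) := fun x => by
    obtain ⟨i, hi⟩ := exists_eq_ciSup_of_finite (f := fun i : Fin m => u (x ++ [i]))
    exact ⟨i, hi.symm⟩
  have selmin : ∀ x : List (Fin m), ∃ i, treeMin m u x = u (x ++ [i]) := fun x => by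
    obtain ⟨i, hi⟩ := exists_eq_ciInf_of_finite (f := fun i : Fin m => u (x ++ [i]))
    exact ⟨i, hi.symm⟩
  choose imax hmax using selmax
  choose imin hmin using selmin
  constructor
  · refine avg_barrier (ι := Bool) (fun x c => if c then imax x else imin x) hD
      (fun π => (hb π).1) (fun π => (hb π).2) x1 η s hηpos key hp (fun x => ?_) ε hε
    conv_lhs => rw [(hsol x).1, hmax, hmin]
    have e2 : (1 / (Fintype.card Bool : ℝ)) * ∑ c : Bool, u (x ++ [if c then imax x else imin x]) =
        1 / 2 * u (x ++ [imax x]) + 1 / 2 * u (x ++ [imin x]) := by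
      rw [Fintype.sum_bool, Fintype.card_bool]
      simp
      ring
    rw [e2]
  · refine avg_barrier (ι := Fin m) (fun x c => c) (fun x => (hD x).symm)
      (fun π => (hb π).2) (fun π => (hb π).1) x1 η (-s) hηpos
      (fun π hπ => by have := key π hπ; linarith) hq (fun x => ?_) ε hε
    conv_lhs => rw [(hsol x).2]
    simp [treeAvg]

lemma uniform {m : ℕ} (hm : 2 ≤ m) {p q βu βv : ℕ → ℝ}
    (hp : ∀ k, p k ∈ Set.Ico (0 : ℝ) 1) (hq : ∀ k, q k ∈ Set.Ico (0 : ℝ) 1)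
    (hβu : ∀ k, 0 ≤ βu k ∧ βu k < 1) (hβv : ∀ k, 0 ≤ βv k ∧ βv k < 1) {f g : ℝ → ℝ}
    (hf : ContinuousOn f (Set.Icc 0 1)) (hg : ContinuousOn g (Set.Icc 0 1))
    {u v : List (Fin m) → ℝ} (hsol : ∀ x, SolED199At m p q βu βv u v x)
    (hb : BoundaryCond m f g u v) (ε : ℝ) (hε : 0 < ε) :
    ∃ N, ∀ x : List (Fin m), N ≤ x.length →
      |u x - f (psiVertex m x)| ≤ ε ∧ |v x - g (psiVertex m x)| ≤ ε := by
  obtain ⟨D0, hD0⟩ := bounded hm hp hq hβu hβv hf hg hsol hb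
  obtain ⟨C1, hC1⟩ := fbound hf
  obtain ⟨C2, hC2⟩ := fbound hg
  set δ := ε / 4 with hδ
  have hδpos : 0 < δ := by positivity
  obtain ⟨n2, hn2⟩ := osc hm hf hδpos
  obtain ⟨n3, hn3⟩ := osc hm hg hδpos
  have hof : ∀ z y : List (Fin m), z <+: y → n2 ≤ z.length →
      |f (psiVertex m y) - f (psiVertex m z)| ≤ δ := fun z y h hz =>
    hn2 _ hz _ (psiVertex_mem hm _) _ (psiVertex_mem hm _) (psiVertex_prefix hm h)
  have hog : ∀ z y : List (Fin m), z <+: y → n3 ≤ z.length →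
      |g (psiVertex m y) - g (psiVertex m z)| ≤ δ := fun z y h hz =>
    hn3 _ hz _ (psiVertex_mem hm _) _ (psiVertex_mem hm _) (psiVertex_prefix hm h)
  have tri : ∀ {a b c : ℝ} {r s : ℝ}, |a - b| ≤ r → |b - c| ≤ s → |a - c| ≤ r + s :=
    fun h1 h2 => (abs_sub_le _ _ _).trans (add_le_add h1 h2)
  by_cases hne : ∃ x0 : List (Fin m), f (psiVertex m x0) ≠ g (psiVertex m x0)
  · obtain ⟨x0, hx0⟩ := hne
    set D := |D0| + |C1| + |C2| + 1 with hDdef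
    have hDpos : 0 < D := by positivity
    obtain ⟨⟨n4, h, hh, hhs⟩, ⟨n5, k, hk, hks⟩⟩ :=
      two_barriers hm hp hq hf hg hsol hb hD0 x0 hx0 (δ / D) (by positivity)
    obtain ⟨N, hN⟩ := geom hm (fun x => |u x - f (psiVertex m x)| ≤ δ ∧ |v x - g (psiVertex m x)| ≤ δ)
      (fun π => good_ev hm hf hg hb hδpos π) (n2 + n3 + n4 + n5)
    refine ⟨N, fun x hx => ?_⟩
    obtain ⟨z, I, M, hzx, hz0, hzQ, hxI, hI, hc, hd⟩ := hN x hx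
    have hfD : ∀ y, |v y - f (psiVertex m z)| ≤ D := fun y => by
      have := abs_sub (v y) (f (psiVertex m z))
      have := (hD0 y).2
      have := hC1 _ (psiVertex_mem hm z)
      have := le_abs_self D0
      have := le_abs_self C1
      have := abs_nonneg C2
      linarith
    have hgD : ∀ y, |u y - g (psiVertex m z)| ≤ D := fun y => by
      have := abs_sub (u y) (g (psiVertex m z))
      have := (hD0 y).1
      have := hC2 _ (psiVertex_mem hm z)
      have := le_abs_self D0
      have := le_abs_self C2
      have := abs_nonneg C1
      linarith
    constructor
    · have := scalar (D := D) (K := δ + δ) hDpos.le (by positivity) hp hβu (fun n hn => (hh n hn).1) hhs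
        (fun y => |u y - f (psiVertex m z)|) I M (fun y hy => (hI y hy).2.2)
        (fun y hy => by have := (hI y hy).2.1; omega)
        (fun y hy i hi => tri (hc y hy i hi).1
          (hof z _ ((hI y hy).1.trans (List.prefix_append _ _)) (by omega)))
        (fun y hy hi => tri (hd y hy hi).1.1 (hof z _ (hd y hy hi).2 (by omega)))
        (fun y hy => by
          obtain ⟨i, hi⟩ := step_u hm hp hβu (hsol y) (const_sol hm p q βu βv (f (psiVertex m z)) y)
          exact ⟨i, hi.trans (add_le_add le_rfl
            (mul_le_mul_of_nonneg_left (hfD y) (hp _).1))⟩) x hxI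
      have h2 : D * h x.length ≤ δ := by
        have := (hh x.length (by have := (hI x hxI).2.1; omega)).2
        rw [le_div_iff₀ hDpos] at this
        linarith
      have h3 := hof z x hzx (by omega)
      rw [abs_sub_comm] at h3
      refine (tri this h3).trans ?_
      linarith
    · have := scalar (D := D) (K := δ + δ) hDpos.le (by positivity) hq hβv (fun n hn => (hk n hn).1) hks
        (fun y => |v y - g (psiVertex m z)|) I M (fun y hy => (hI y hy).2.2)
        (fun y hy => by have := (hI y hy).2.1; omega)
        (fun y hy i hi => tri (hc y hy i hi).2
          (hog z _ ((hI y hy).1.trans (List.prefix_append _ _)) (by omega)))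
        (fun y hy hi => tri (hd y hy hi).1.2 (hog z _ (hd y hy hi).2 (by omega)))
        (fun y hy => by
          obtain ⟨i, hi⟩ := step_v hm hq hβv (hsol y) (const_sol hm p q βu βv (g (psiVertex m z)) y)
          exact ⟨i, hi.trans (add_le_add le_rfl
            (mul_le_mul_of_nonneg_left (hgD y) (hq _).1))⟩) x hxI
      have h2 : D * k x.length ≤ δ := by
        have := (hk x.length (by have := (hI x hxI).2.1; omega)).2
        rw [le_div_iff₀ hDpos] at this
        linarith
      have h3 := hog z x hzx (by omega)
      rw [abs_sub_comm] at h3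
      refine (tri this h3).trans ?_
      linarith
  · push Not at hne
    obtain ⟨N, hN⟩ := geom hm (fun x => |u x - f (psiVertex m x)| ≤ δ ∧ |v x - g (psiVertex m x)| ≤ δ)
      (fun π => good_ev hm hf hg hb hδpos π) (n2 + n3)
    refine ⟨N, fun x hx => ?_⟩
    obtain ⟨z, I, M, hzx, hz0, hzQ, hxI, hI, hc, hd⟩ := hN x hx
    have := coupled hm hp hq hβu hβv (u := u) (v := v) (u' := fun _ => f (psiVertex m z))
      (v' := fun _ => f (psiVertex m z)) I M (δ + δ)
      (fun y hy => (hI y hy).2.2) (fun y _ => hsol y) (fun y _ => const_sol hm p q βu βv _ y)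
      (fun y hy i hi => by
        have hpre := (hI y hy).1.trans (List.prefix_append _ [i])
        refine ⟨tri (hc y hy i hi).1 (hof z _ hpre (by omega)), ?_⟩
        rw [hne z]
        exact tri (hc y hy i hi).2 (hog z _ hpre (by omega)))
      (fun y hy hi => by
        refine ⟨tri (hd y hy hi).1.1 (hof z _ (hd y hy hi).2 (by omega)), ?_⟩
        rw [hne z]
        exact tri (hd y hy hi).1.2 (hog z _ (hd y hy hi).2 (by omega))) x hxI
    have h3 := hof z x hzx (by omega)
    rw [abs_sub_comm] at h3
    refine ⟨(tri this.1 h3).trans (by linarith), ?_⟩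
    rw [← hne x]
    exact (tri this.2 h3).trans (by linarith)

/-- the finite-level (game) values converge, as the level goes to
infinity, to the unique solution of the system (ED1.99) with boundary data `f, g`. -/
theorem stmt14 (m : ℕ) (hm : 2 ≤ m)
    (p q βu βv : ℕ → ℝ)
    (hp : ∀ k, p k ∈ Set.Ico (0 : ℝ) 1) (hq : ∀ k, q k ∈ Set.Ico (0 : ℝ) 1)
    (c : ℝ) (hc : c < 1)
    (hβu : ∀ k, βu k ∈ Set.Icc (0 : ℝ) c) (hβv : ∀ k, βv k ∈ Set.Icc (0 : ℝ) c)
    (hβu0 : βu 0 = 0) (hβv0 : βv 0 = 0)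
    (hsump : Summable p) (hsumq : Summable q)
    (hsumβu : Summable (fun k => ∏ j ∈ Finset.Icc 1 k, βu j / (1 - βu j)))
    (hsumβv : Summable (fun k => ∏ j ∈ Finset.Icc 1 k, βv j / (1 - βv j)))
    (f g : ℝ → ℝ) (hf : ContinuousOn f (Set.Icc 0 1)) (hg : ContinuousOn g (Set.Icc 0 1))
    (uL vL : ℕ → List (Fin m) → ℝ)
    (hLsol : ∀ L : ℕ, ∀ x : List (Fin m), x.length < L →
      SolED199At m p q βu βv (uL L) (vL L) x)
    (hLbdry : ∀ L : ℕ, ∀ x : List (Fin m), x.length = L →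
      uL L x = f (psiVertex m x) ∧ vL L x = g (psiVertex m x))
    (u v : List (Fin m) → ℝ)
    (hsol : ∀ x : List (Fin m), SolED199At m p q βu βv u v x)
    (hbdry : BoundaryCond m f g u v)
    (huniq : ∀ u' v' : List (Fin m) → ℝ,
      (∀ x : List (Fin m), SolED199At m p q βu βv u' v' x) →
      BoundaryCond m f g u' v' → u' = u ∧ v' = v) :
    ∀ x : List (Fin m),
      Tendsto (fun L => uL L x) atTop (𝓝 (u x)) ∧
      Tendsto (fun L => vL L x) atTop (𝓝 (v x)) := by

  have hβu' : ∀ k, 0 ≤ βu k ∧ βu k < 1 := fun k => ⟨(hβu k).1, (hβu k).2.trans_lt hc⟩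
  have hβv' : ∀ k, 0 ≤ βv k ∧ βv k < 1 := fun k => ⟨(hβv k).1, (hβv k).2.trans_lt hc⟩
  intro x
  have main : ∀ ε : ℝ, 0 < ε → ∃ N, ∀ L, N ≤ L → |uL L x - u x| ≤ ε ∧ |vL L x - v x| ≤ ε := by
    intro ε hε
    obtain ⟨N, hN⟩ := uniform hm hp hq hβu' hβv' hf hg hsol hbdry ε hε
    refine ⟨max N (x.length + 1), fun L hL => ?_⟩
    have hNL : N ≤ L := (le_max_left _ _).trans hL
    have hxL : x.length + 1 ≤ L := (le_max_right _ _).trans hL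
    refine coupled hm hp hq hβu' hβv' {y | y.length < L} L ε (fun y hy => hy)
      (fun y hy => hLsol L y hy) (fun y _ => hsol y) ?_ ?_ x (by simp; omega)
    · intro y hy i hi
      have hl : (y ++ [i]).length = L := by
        simp only [Set.mem_ofPred_eq, List.length_append, List.length_singleton] at hy hi ⊢
        omega
      have h1 := hLbdry L _ hl
      have h2 := hN (y ++ [i]) (by omega)
      rw [h1.1, h1.2, abs_sub_comm, abs_sub_comm (g _)]
      exact h2
    · intro y hy hi
      simp only [Set.mem_ofPred_eq, List.length_dropLast] at hy hi
      omega
  constructor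
  · rw [Metric.tendsto_atTop]
    intro ε hε
    obtain ⟨N, hN⟩ := main (ε / 2) (by positivity)
    exact ⟨N, fun L hL => by rw [Real.dist_eq]; linarith [(hN L hL).1]⟩
  · rw [Metric.tendsto_atTop]
    intro ε hε
    obtain ⟨N, hN⟩ := main (ε / 2) (by positivity)
    exact ⟨N, fun L hL => by rw [Real.dist_eq]; linarith [(hN L hL).2]⟩
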